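/- arXiv:1802.08498 — 2 statements merged into one kernel-verified Lean document; each statement's English description precedes it below -/
import Mathlib

section
/- Fix an integer N ≥ 0 and let 𝐢 ∈ τ_N be a tuple that is not the lexicographically largest element of τ_N, and let 𝐢' ∈ τ_N be the immediate successor of 𝐢 in the lexicographic order restricted to the finite set τ_N. Then Ŵ_{𝐢'} ⊆ Ŵ_𝐢, and the quotient vector space Ŵ_𝐢 / Ŵ_{𝐢'} is ℂ-linearly isomorphic to ℂ[x]_{N−‖𝐢‖} / I^𝐢_N; in particular dim_ℂ(Ŵ_𝐢 / Ŵ_{𝐢'}) = Δ^𝐢_N. -/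
open MvPolynomial

noncomputable section

/-- The degree-`d` homogeneous part `ℂ[x]_d` of `ℂ[x_0,…,x_M]`. -/
def homogPart (M d : ℕ) : Submodule ℂ (MvPolynomial (Fin (M + 1)) ℂ) :=
  homogeneousSubmodule (Fin (M + 1)) ℂ d

/-- `‖𝐢‖ = i_1 + ⋯ + i_n`. -/
def normI {n : ℕ} (i : Fin n → ℕ) : ℕ := ∑ j, i j

/-- `r^𝐢 = r_1^{i_1} ⋯ r_n^{i_n}`. -/
def rPow {M n : ℕ} (r : Fin n → MvPolynomial (Fin (M + 1)) ℂ) (i : Fin n → ℕ) :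
    MvPolynomial (Fin (M + 1)) ℂ := ∏ j, (r j) ^ (i j)

/-- The space `I^𝐢_N`: all `p ∈ ℂ[x]_{N-‖𝐢‖}` such that
`r^𝐢·p - Σ_{𝐞 >_lex 𝐢, ‖𝐞‖ ≤ N} r^𝐞·c 𝐞 ∈ I_N = I ∩ ℂ[x]_N` for suitable
`c 𝐞 ∈ ℂ[x]_{N-‖𝐞‖}`. -/
def IfilSet (M n : ℕ) (I : Ideal (MvPolynomial (Fin (M + 1)) ℂ))
    (r : Fin n → MvPolynomial (Fin (M + 1)) ℂ) (i : Fin n → ℕ) (N : ℕ) :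
    Set (MvPolynomial (Fin (M + 1)) ℂ) :=
  {p | p ∈ homogPart M (N - normI i) ∧
    ∃ (s : Finset (Fin n → ℕ)) (c : (Fin n → ℕ) → MvPolynomial (Fin (M + 1)) ℂ),
      (∀ e ∈ s, toLex i < toLex e ∧ normI e ≤ N ∧ c e ∈ homogPart M (N - normI e)) ∧
      (rPow r i * p - ∑ e ∈ s, rPow r e * c e ∈ I ∧
        rPow r i * p - ∑ e ∈ s, rPow r e * c e ∈ homogPart M N)}

/-- The ideal `I^𝐢` generated by `⋃_{N ≥ ‖𝐢‖} I^𝐢_N`. -/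
def Iideal (M n : ℕ) (I : Ideal (MvPolynomial (Fin (M + 1)) ℂ))
    (r : Fin n → MvPolynomial (Fin (M + 1)) ℂ) (i : Fin n → ℕ) :
    Ideal (MvPolynomial (Fin (M + 1)) ℂ) :=
  Ideal.span {p | ∃ N, normI i ≤ N ∧ p ∈ IfilSet M n I r i N}

/-- `Δ^𝐢_N = dim_ℂ (ℂ[x]_{N-‖𝐢‖} / I^𝐢_N)`. -/
def Delta (M n : ℕ) (I : Ideal (MvPolynomial (Fin (M + 1)) ℂ))
    (r : Fin n → MvPolynomial (Fin (M + 1)) ℂ) (i : Fin n → ℕ) (N : ℕ) : ℕ :=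
  Module.finrank ℂ
    (↥(homogPart M (N - normI i)) ⧸
      (Submodule.span ℂ (IfilSet M n I r i N)).comap (homogPart M (N - normI i)).subtype)

/-- `dim_ℂ (ℂ[x]_N / I_N)`, the Hilbert function of `I`. -/
def DeltaV (M : ℕ) (I : Ideal (MvPolynomial (Fin (M + 1)) ℂ)) (N : ℕ) : ℕ :=
  Module.finrank ℂ
    (↥(homogPart M N) ⧸ (I.restrictScalars ℂ).comap (homogPart M N).subtype)

/-- `τ_N = {𝐢 ∈ ℤ_{≥0}^n : ‖𝐢‖ ≤ N}` as a `Finset`. -/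
def tauN (n N : ℕ) : Finset (Fin n → ℕ) :=
  (Fintype.piFinset fun _ : Fin n => Finset.range (N + 1)).filter fun i => normI i ≤ N

/-- The ideal `I` is homogeneous: it contains every homogeneous component of its members. -/
def IsHomogeneousIdeal {M : ℕ} (I : Ideal (MvPolynomial (Fin (M + 1)) ℂ)) : Prop :=
  ∀ p ∈ I, ∀ d : ℕ, homogeneousComponent d p ∈ I

end

noncomputable section

/-- `W_𝐢 = Σ_{𝐞 ∈ τ_N, 𝐞 ≥_lex 𝐢} r^𝐞·ℂ[x]_{N-‖𝐞‖}`, a subspace of `ℂ[x]_N`. -/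
def Wsub (M n : ℕ) (r : Fin n → MvPolynomial (Fin (M + 1)) ℂ) (N : ℕ) (i : Fin n → ℕ) :
    Submodule ℂ (MvPolynomial (Fin (M + 1)) ℂ) :=
  ⨆ (e : Fin n → ℕ) (_ : normI e ≤ N ∧ toLex i ≤ toLex e),
    Submodule.map (LinearMap.mulLeft ℂ (rPow r e)) (homogPart M (N - normI e))

/-- `Ŵ_𝐢`, the image of `W_𝐢` under the quotient map modulo `I`. -/
def What (M n : ℕ) (I : Ideal (MvPolynomial (Fin (M + 1)) ℂ))
    (r : Fin n → MvPolynomial (Fin (M + 1)) ℂ) (N : ℕ) (i : Fin n → ℕ) :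
    Submodule ℂ ((MvPolynomial (Fin (M + 1)) ℂ) ⧸ (I.restrictScalars ℂ)) :=
  (Wsub M n r N i).map (I.restrictScalars ℂ).mkQ

end

/-- If `V = V' + f(A)`, then `f` induces an isomorphism of `V / V'` with `A / f⁻¹(V')`. -/
theorem nonempty_quotient_equiv_of_eq_sup_range {K A Q : Type*} [Ring K]
    [AddCommGroup A] [Module K A] [AddCommGroup Q] [Module K Q]
    (f : A →ₗ[K] Q) {V V' : Submodule K Q} (h : V = V' ⊔ LinearMap.range f) :
    Nonempty ((↥V ⧸ V'.comap V.subtype) ≃ₗ[K] (A ⧸ V'.comap f)) := by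
  have hf : ∀ a, f a ∈ V := fun a => h ▸ Submodule.mem_sup_right ⟨a, rfl⟩
  let φ : A →ₗ[K] (↥V ⧸ V'.comap V.subtype) := (V'.comap V.subtype).mkQ ∘ₗ f.codRestrict V hf
  have hker : LinearMap.ker φ = V'.comap f := by
    ext a
    simp [φ, Submodule.Quotient.mk_eq_zero]
  have hsurj : Function.Surjective φ := by
    intro y
    obtain ⟨⟨v, hv⟩, rfl⟩ := Submodule.mkQ_surjective _ y
    obtain ⟨w, hw, _, ⟨a, rfl⟩, rfl⟩ := Submodule.mem_sup.1 (h ▸ hv)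
    refine ⟨a, ?_⟩
    simp only [φ, LinearMap.comp_apply, Submodule.mkQ_apply]
    rw [Submodule.Quotient.eq]
    simpa using hw
  exact ⟨((Submodule.quotEquivOfEq _ _ hker.symm).trans
    (φ.quotKerEquivOfSurjective hsurj)).symm⟩

theorem mem_tauN {n N : ℕ} {e : Fin n → ℕ} : e ∈ tauN n N ↔ normI e ≤ N := by
  simp only [tauN, Finset.mem_filter, Fintype.mem_piFinset, Finset.mem_range, and_iff_right_iff_imp]
  intro h j
  exact Nat.lt_succ_of_le ((Finset.single_le_sum (fun _ _ => Nat.zero_le _)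
    (Finset.mem_univ j)).trans h)

theorem rPow_mem_homogPart {M n : ℕ} {r : Fin n → MvPolynomial (Fin (M + 1)) ℂ}
    (hr : ∀ j, r j ∈ homogPart M 1) (e : Fin n → ℕ) : rPow r e ∈ homogPart M (normI e) := by
  have h := IsHomogeneous.prod Finset.univ (fun j => r j ^ e j) (fun j => 1 * e j)
    fun j _ => IsHomogeneous.pow (hr j) (e j)
  simpa [homogPart, normI, rPow] using h

theorem rPow_mul_mem_homogPart {M n N : ℕ} {r : Fin n → MvPolynomial (Fin (M + 1)) ℂ}
    (hr : ∀ j, r j ∈ homogPart M 1) {e : Fin n → ℕ} (he : normI e ≤ N)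
    {p : MvPolynomial (Fin (M + 1)) ℂ} (hp : p ∈ homogPart M (N - normI e)) :
    rPow r e * p ∈ homogPart M N := by
  have h := IsHomogeneous.mul (rPow_mem_homogPart hr e) hp
  rwa [Nat.add_sub_cancel' he] at h

theorem rPow_mul_mem_Wsub {M n N : ℕ} (r : Fin n → MvPolynomial (Fin (M + 1)) ℂ)
    {i e : Fin n → ℕ} (he : normI e ≤ N) (hie : toLex i ≤ toLex e)
    {p : MvPolynomial (Fin (M + 1)) ℂ} (hp : p ∈ homogPart M (N - normI e)) :
    rPow r e * p ∈ Wsub M n r N i :=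
  Submodule.mem_iSup_of_mem e (Submodule.mem_iSup_of_mem ⟨he, hie⟩ ⟨p, hp, rfl⟩)

theorem Wsub_le_homogPart {M n N : ℕ} {r : Fin n → MvPolynomial (Fin (M + 1)) ℂ}
    (hr : ∀ j, r j ∈ homogPart M 1) (i : Fin n → ℕ) : Wsub M n r N i ≤ homogPart M N := by
  refine iSup₂_le fun e he => ?_
  rintro _ ⟨p, hp, rfl⟩
  exact rPow_mul_mem_homogPart hr he.1 hp

theorem Wsub_anti {M n N : ℕ} (r : Fin n → MvPolynomial (Fin (M + 1)) ℂ)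
    {i i' : Fin n → ℕ} (h : toLex i ≤ toLex i') : Wsub M n r N i' ≤ Wsub M n r N i := by
  refine iSup₂_le fun e he => ?_
  rintro _ ⟨p, hp, rfl⟩
  exact rPow_mul_mem_Wsub r he.1 (h.trans he.2) hp

theorem exists_sum_of_mem_Wsub {M n N : ℕ} {r : Fin n → MvPolynomial (Fin (M + 1)) ℂ}
    {i : Fin n → ℕ} {w : MvPolynomial (Fin (M + 1)) ℂ} (hw : w ∈ Wsub M n r N i) :
    ∃ (s : Finset (Fin n → ℕ)) (c : (Fin n → ℕ) → MvPolynomial (Fin (M + 1)) ℂ),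
      (∀ e ∈ s, toLex i ≤ toLex e ∧ normI e ≤ N ∧ c e ∈ homogPart M (N - normI e)) ∧
      w = ∑ e ∈ s, rPow r e * c e := by
  obtain ⟨f, hf, rfl⟩ := (Submodule.mem_iSup_iff_exists_finsupp _ _).1 hw
  have key : ∀ e, ∃ c, e ∈ f.support → toLex i ≤ toLex e ∧ normI e ≤ N ∧
      c ∈ homogPart M (N - normI e) ∧ rPow r e * c = f e := by
    intro e
    by_cases he : normI e ≤ N ∧ toLex i ≤ toLex e
    · have h := hf e
      rw [iSup_pos he] at h
      obtain ⟨c, hc, hce⟩ := h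
      exact ⟨c, fun _ => ⟨he.2, he.1, hc, hce⟩⟩
    · have h := hf e
      rw [iSup_neg he, Submodule.mem_bot] at h
      exact ⟨0, fun hs => absurd h (Finsupp.mem_support_iff.1 hs)⟩
  choose c hc using key
  exact ⟨f.support, c, fun e he => ⟨(hc e he).1, (hc e he).2.1, (hc e he).2.2.1⟩,
    Finset.sum_congr rfl fun e he => (hc e he).2.2.2.symm⟩

theorem mem_IfilSet_iff {M n N : ℕ} {I : Ideal (MvPolynomial (Fin (M + 1)) ℂ)}
    {r : Fin n → MvPolynomial (Fin (M + 1)) ℂ} (hr : ∀ j, r j ∈ homogPart M 1)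
    {i i' : Fin n → ℕ} (hi : normI i ≤ N) (hlt : toLex i < toLex i')
    (hsucc : ∀ e ∈ tauN n N, toLex i < toLex e → toLex i' ≤ toLex e)
    {p : MvPolynomial (Fin (M + 1)) ℂ} :
    p ∈ IfilSet M n I r i N ↔ p ∈ homogPart M (N - normI i) ∧
      (I.restrictScalars ℂ).mkQ (rPow r i * p) ∈ What M n I r N i' := by
  refine and_congr_right fun hp => ⟨?_, ?_⟩
  · rintro ⟨s, c, hs, hI, -⟩
    refine ⟨∑ e ∈ s, rPow r e * c e, Submodule.sum_mem _ fun e he => ?_, ?_⟩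
    · obtain ⟨hie, heN, hce⟩ := hs e he
      exact rPow_mul_mem_Wsub r heN (hsucc e (mem_tauN.2 heN) hie) hce
    · exact ((Submodule.Quotient.eq _).2 hI).symm
  · rintro ⟨w, hw, hwp⟩
    have hwN := Wsub_le_homogPart hr i' hw
    obtain ⟨s, c, hs, rfl⟩ := exists_sum_of_mem_Wsub hw
    exact ⟨s, c, fun e he => ⟨hlt.trans_le (hs e he).1, (hs e he).2⟩,
      (Submodule.Quotient.eq (I.restrictScalars ℂ)).1 hwp.symm,
      Submodule.sub_mem _ (rPow_mul_mem_homogPart hr hi hp) hwN⟩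

theorem Wsub_eq_sup {M n N : ℕ} (r : Fin n → MvPolynomial (Fin (M + 1)) ℂ)
    {i i' : Fin n → ℕ} (hi : normI i ≤ N) (hlt : toLex i < toLex i')
    (hsucc : ∀ e ∈ tauN n N, toLex i < toLex e → toLex i' ≤ toLex e) :
    Wsub M n r N i = Wsub M n r N i' ⊔
      (homogPart M (N - normI i)).map (LinearMap.mulLeft ℂ (rPow r i)) := by
  apply le_antisymm
  · refine iSup₂_le fun e he => ?_
    rcases he.2.eq_or_lt with h | h
    · obtain rfl : i = e := toLex.injective h
      exact le_sup_right
    · refine le_trans ?_ le_sup_left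
      rintro _ ⟨p, hp, rfl⟩
      exact rPow_mul_mem_Wsub r he.1 (hsucc e (mem_tauN.2 he.1) h) hp
  · refine sup_le (Wsub_anti r hlt.le) ?_
    rintro _ ⟨p, hp, rfl⟩
    exact rPow_mul_mem_Wsub r hi le_rfl hp

/-- If `𝐢' ∈ τ_N` is the immediate lexicographic successor of `𝐢 ∈ τ_N`, then
`Ŵ_{𝐢'} ⊆ Ŵ_𝐢` and `Ŵ_𝐢 / Ŵ_{𝐢'} ≅ ℂ[x]_{N-‖𝐢‖} / I^𝐢_N`; in particular
`dim_ℂ (Ŵ_𝐢 / Ŵ_{𝐢'}) = Δ^𝐢_N`. -/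
theorem What_quotient_iso (M n : ℕ) (hM : 1 ≤ M) (hn : 1 ≤ n)
    (I : Ideal (MvPolynomial (Fin (M + 1)) ℂ)) (hI : IsHomogeneousIdeal I)
    (r : Fin n → MvPolynomial (Fin (M + 1)) ℂ)
    (hr : ∀ j, r j ≠ 0 ∧ r j ∈ homogPart M 1)
    (N : ℕ) (i i' : Fin n → ℕ) (hi : i ∈ tauN n N) (hi' : i' ∈ tauN n N)
    (hlt : toLex i < toLex i')
    (hsucc : ∀ e ∈ tauN n N, toLex i < toLex e → toLex i' ≤ toLex e) :
    What M n I r N i' ≤ What M n I r N i ∧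
    Nonempty
      ((↥(What M n I r N i) ⧸ (What M n I r N i').comap (What M n I r N i).subtype) ≃ₗ[ℂ]
        (↥(homogPart M (N - normI i)) ⧸
          (Submodule.span ℂ (IfilSet M n I r i N)).comap (homogPart M (N - normI i)).subtype)) ∧
    Module.finrank ℂ
        (↥(What M n I r N i) ⧸ (What M n I r N i').comap (What M n I r N i).subtype)
      = Delta M n I r i N := by
  have hr1 : ∀ j, r j ∈ homogPart M 1 := fun j => (hr j).2
  have hiN := mem_tauN.1 hi
  let f : ↥(homogPart M (N - normI i)) →ₗ[ℂ]
      (MvPolynomial (Fin (M + 1)) ℂ) ⧸ (I.restrictScalars ℂ) :=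
    (I.restrictScalars ℂ).mkQ ∘ₗ LinearMap.mulLeft ℂ (rPow r i) ∘ₗ
      (homogPart M (N - normI i)).subtype
  have hsup : What M n I r N i = What M n I r N i' ⊔ LinearMap.range f := by
    rw [What, Wsub_eq_sup r hiN hlt hsucc, Submodule.map_sup]
    simp only [f, LinearMap.range_comp, Submodule.range_subtype, What]
  have hspan : (Submodule.span ℂ (IfilSet M n I r i N)).comap
      (homogPart M (N - normI i)).subtype = (What M n I r N i').comap f := by
    have hset : IfilSet M n I r i N =
        ((What M n I r N i').comap f).map (homogPart M (N - normI i)).subtype := by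
      ext p
      rw [mem_IfilSet_iff hr1 hiN hlt hsucc]
      constructor
      · rintro ⟨hp, hw⟩
        exact ⟨⟨p, hp⟩, hw, rfl⟩
      · rintro ⟨⟨q, hq⟩, hw, rfl⟩
        exact ⟨hq, hw⟩
    rw [hset, Submodule.span_eq, Submodule.comap_map_eq_of_injective Subtype.val_injective]
  have key := nonempty_quotient_equiv_of_eq_sup_range f hsup
  rw [← hspan] at key
  exact ⟨Submodule.map_mono (Wsub_anti r hlt.le), key, key.some.finrank_eq⟩
end

section
/- Assume that the quotient ring ℂ[x_0,…,x_M]/(I + (r_1,…,r_n)) has Krull dimension at most 1, where I + (r_1,…,r_n) is the ideal generated by I together with r_1,…,r_n. Then there exists a non-negative integer N_0 such that for every 𝐢 ∈ ℤ_{≥0}^n, the quantity Δ^𝐢_N takes one and the same value for all integers N with N − ‖𝐢‖ > N_0. -/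
open MvPolynomial

namespace MvPolynomial

variable {σ R : Type*} [CommRing R]

theorem homogeneousComponent_mul_of_isHomogeneous {q : MvPolynomial σ R} {d : ℕ}
    (hq : q.IsHomogeneous d) (N : ℕ) (c : MvPolynomial σ R) :
    homogeneousComponent N (q * c) =
      if d ≤ N then q * homogeneousComponent (N - d) c else 0 := by
  let := gradedAlgebra (σ := σ) (R := R)
  have hcomp (m : ℕ) (f : MvPolynomial σ R) :
      (DirectSum.decompose (homogeneousSubmodule σ R) f m : MvPolynomial σ R) =
        homogeneousComponent m f := decomposition.decompose'_apply f m
  split_ifs with h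
  · rw [← hcomp, ← hcomp]
    exact DirectSum.coe_decompose_mul_of_left_mem_of_le _ hq h
  · rw [← hcomp]
    exact DirectSum.coe_decompose_mul_of_left_mem_of_not_le _ hq h

theorem homogeneousComponent_mem_sup_span {I : Ideal (MvPolynomial σ R)}
    (hI : ∀ p ∈ I, ∀ d, homogeneousComponent d p ∈ I) {S : Set (MvPolynomial σ R)}
    (hS : ∀ s ∈ S, ∃ d, s.IsHomogeneous d) :
    ∀ p ∈ I ⊔ Ideal.span S, ∀ d, homogeneousComponent d p ∈ I ⊔ Ideal.span S := by
  let := gradedAlgebra (σ := σ) (R := R)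
  have hI' : I.IsHomogeneous (homogeneousSubmodule σ R) := fun d p hp ↦ by
    have := hI p hp d
    rwa [← decomposition.decompose'_apply] at this
  have hS' : (Ideal.span S).IsHomogeneous (homogeneousSubmodule σ R) :=
    Ideal.homogeneous_span _ _ hS
  exact fun p hp d ↦ homogeneousComponent_mem_of_mem (hI'.sup hS') hp d

theorem isMaximal_of_X_mem {k : Type*} [Field k] {Q : Ideal (MvPolynomial σ k)} (hQ : Q ≠ ⊤)
    (hX : ∀ j, X j ∈ Q) : Q.IsMaximal := by
  have hmax : (RingHom.ker (constantCoeff (R := k) (σ := σ))).IsMaximal :=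
    RingHom.ker_isMaximal_of_surjective _ fun a ↦ ⟨C a, constantCoeff_C _ a⟩
  have hle : RingHom.ker (constantCoeff (R := k) (σ := σ)) ≤ Q := by
    intro p hp
    have hp' : p ∈ idealOfVars σ k ^ 1 := by
      rw [mem_pow_idealOfVars_iff']
      intro x hx
      obtain rfl : x = 0 := by simpa [Finsupp.degree_eq_zero_iff] using hx
      exact hp
    rw [pow_one] at hp'
    exact Ideal.span_le.2 (Set.range_subset_iff.2 hX) hp'
  exact hmax.eq_of_le hQ hle ▸ hmax

/-- A linear form that lies in none of finitely many given ideals, apart from those containing all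
the variables. -/
theorem exists_isHomogeneous_one_notMem {k : Type*} [Field k] [Infinite k] [Finite σ]
    {s : Set (Ideal (MvPolynomial σ k))} (hs : s.Finite) :
    ∃ l : MvPolynomial σ k, l.IsHomogeneous 1 ∧ ∀ p ∈ s, l ∈ p → ∀ j, X j ∈ p := by
  classical
  let V := homogeneousSubmodule σ k 1
  let W (p : Ideal (MvPolynomial σ k)) : Subspace k V := (p.restrictScalars k).comap V.subtype
  let t : Finset (Subspace k V) := (hs.toFinset.image W).erase ⊤
  have ht : ⊤ ∉ t := Finset.notMem_erase _ _
  obtain ⟨l, hl⟩ := (Set.ne_univ_iff_exists_notMem _).1 (Subspace.biUnion_ne_univ_of_top_notMem ht)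
  refine ⟨l, l.2, fun p hp hlp j ↦ ?_⟩
  by_contra hj
  refine hl (Set.mem_biUnion (x := W p) ?_ hlp)
  refine Finset.mem_coe.2 (Finset.mem_erase.2 ⟨fun htop ↦ hj ?_, ?_⟩)
  · have : (⟨X j, isHomogeneous_X k j⟩ : V) ∈ W p := htop ▸ Submodule.mem_top
    exact this
  · exact Finset.mem_image_of_mem _ (hs.mem_toFinset.2 hp)

theorem krullDimLE_zero_quotient_sup_span_singleton {k : Type*} [Field k]
    {K : Ideal (MvPolynomial σ k)} (hK : Ring.KrullDimLE 1 (MvPolynomial σ k ⧸ K))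
    {l : MvPolynomial σ k} (hl : ∀ p ∈ K.minimalPrimes, l ∈ p → ∀ j, X j ∈ p) :
    Ring.KrullDimLE 0 (MvPolynomial σ k ⧸ K ⊔ Ideal.span {l}) := by
  refine Ring.krullDimLE_zero_iff.2 fun Q' hQ' ↦ ?_
  let f := Ideal.Quotient.mk (K ⊔ Ideal.span {l})
  have hf : Function.Surjective f := Ideal.Quotient.mk_surjective
  let Q := Q'.comap f
  have hQ : Q.IsPrime := hQ'.comap f
  have hLQ : K ⊔ Ideal.span {l} ≤ Q := by
    rw [← Ideal.mk_ker (I := K ⊔ Ideal.span {l})]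
    exact Ideal.ker_le_comap f
  suffices hmax : Q.IsMaximal by
    have := Ideal.map_eq_top_or_isMaximal_of_surjective f hf hmax
    rw [Ideal.map_comap_of_surjective f hf] at this
    exact this.resolve_left hQ'.ne_top
  have hKQ : K ≤ Q := le_sup_left.trans hLQ
  have hlQ : l ∈ Q := hLQ (Ideal.mem_sup_right (Ideal.mem_span_singleton_self l))
  obtain ⟨p, hp, hpQ⟩ := Ideal.exists_minimalPrimes_le hKQ
  by_cases hlp : l ∈ p
  · exact isMaximal_of_X_mem hQ.ne_top fun j ↦ hpQ (hl p hp hlp j)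
  have hg : Function.Surjective (Ideal.Quotient.mk K) := Ideal.Quotient.mk_surjective
  have hcomap {J : Ideal (MvPolynomial σ k)} (hJ : K ≤ J) :
      (J.map (Ideal.Quotient.mk K)).comap (Ideal.Quotient.mk K) = J := by
    rw [Ideal.comap_map_of_surjective _ hg, ← RingHom.ker_eq_comap_bot, Ideal.mk_ker,
      sup_eq_left.2 hJ]
  have hprime {J : Ideal (MvPolynomial σ k)} (hJ : K ≤ J) (h : J.IsPrime) :
      (J.map (Ideal.Quotient.mk K)).IsPrime :=
    Ideal.map_isPrime_of_surjective hg (by rwa [Ideal.mk_ker])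
  rcases Ring.krullDimLE_one_iff.1 hK _ (hprime hKQ hQ) with hmin | hmax
  · have hle := hmin.2 ⟨hprime hp.1.2 hp.1.1, bot_le⟩ (Ideal.map_mono hpQ)
    have := Ideal.comap_mono (f := Ideal.Quotient.mk K) hle
    rw [hcomap hKQ, hcomap hp.1.2] at this
    exact absurd (this hlQ) hlp
  · have := Ideal.comap_isMaximal_of_surjective (Ideal.Quotient.mk K) hg 
      (K := Q.map (Ideal.Quotient.mk K))
    rwa [hcomap hKQ] at this

theorem exists_homogeneousSubmodule_le_of_isArtinianRing {L : Ideal (MvPolynomial σ R)}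
    (hL : ∀ p ∈ L, ∀ d, homogeneousComponent d p ∈ L) [IsArtinianRing (MvPolynomial σ R ⧸ L)] :
    ∃ d₀, ∀ d ≥ d₀, ∀ f : MvPolynomial σ R, f.IsHomogeneous d → f ∈ L := by
  let F : ℕ →o (Ideal (MvPolynomial σ R ⧸ L))ᵒᵈ :=
    ⟨fun d ↦ OrderDual.toDual ((idealOfVars σ R ^ d).map (Ideal.Quotient.mk L)),
      fun a b hab ↦ OrderDual.toDual_le_toDual.2 (Ideal.map_mono (Ideal.pow_le_pow_right hab))⟩
  obtain ⟨d₀, hd₀⟩ := IsArtinian.monotone_stabilizes F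
  refine ⟨d₀, fun d hd f hf ↦ ?_⟩
  have hF : (idealOfVars σ R ^ d).map (Ideal.Quotient.mk L) =
      (idealOfVars σ R ^ (d + 1)).map (Ideal.Quotient.mk L) :=
    OrderDual.toDual.injective ((hd₀ d hd).symm.trans (hd₀ (d + 1) (hd.trans d.le_succ)))
  have hfd : f ∈ idealOfVars σ R ^ d := by
    rw [mem_pow_idealOfVars_iff']
    exact fun x hx ↦ hf.coeff_eq_zero hx.ne
  have hmem := Ideal.mem_map_of_mem (Ideal.Quotient.mk L) hfd
  rw [hF, Ideal.mem_map_iff_of_surjective _ Ideal.Quotient.mk_surjective] at hmem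
  obtain ⟨g, hg, hgf⟩ := hmem
  have hsub := hL _ (Ideal.Quotient.eq.1 hgf.symm) d
  have hg0 : homogeneousComponent d g = 0 :=
    homogeneousComponent_eq_zero' _ _ fun x hx ↦
      (Nat.lt_of_succ_le ((mem_pow_idealOfVars_iff _ _).1 hg x hx)).ne'
  rwa [map_sub, hg0, sub_zero, homogeneousComponent_eq_self hf] at hsub

/-- In a homogeneous quotient of Krull dimension at most one, multiplication by a suitable linear
form is surjective in all large degrees. -/
theorem exists_linear_form_of_krullDimLE_one {k : Type*} [Field k] [Infinite k] [Finite σ]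
    {K : Ideal (MvPolynomial σ k)} (hK : ∀ p ∈ K, ∀ d, homogeneousComponent d p ∈ K)
    (hdim : Ring.KrullDimLE 1 (MvPolynomial σ k ⧸ K)) :
    ∃ l : MvPolynomial σ k, l.IsHomogeneous 1 ∧ ∃ d₀, ∀ d ≥ d₀, ∀ f : MvPolynomial σ k,
      f.IsHomogeneous (d + 1) → ∃ g : MvPolynomial σ k, g.IsHomogeneous d ∧ f - l * g ∈ K := by
  obtain ⟨l, hl, hlp⟩ := exists_isHomogeneous_one_notMem
    (K.finite_minimalPrimes_of_isNoetherianRing (MvPolynomial σ k))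
  have := krullDimLE_zero_quotient_sup_span_singleton hdim hlp
  have : IsArtinianRing (MvPolynomial σ k ⧸ K ⊔ Ideal.span {l}) :=
    IsNoetherianRing.isArtinianRing_of_krullDimLE_zero
  obtain ⟨d₀, hd₀⟩ := exists_homogeneousSubmodule_le_of_isArtinianRing
    (homogeneousComponent_mem_sup_span hK (S := {l}) (by rintro _ rfl; exact ⟨1, hl⟩))
  refine ⟨l, hl, d₀, fun d hd f hf ↦ ?_⟩
  obtain ⟨a, ha, b, hb, hab⟩ := Submodule.mem_sup.1 (hd₀ (d + 1) (hd.trans d.le_succ) f hf)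
  obtain ⟨g, rfl⟩ := Ideal.mem_span_singleton'.1 hb
  refine ⟨homogeneousComponent d g, homogeneousComponent_isHomogeneous d g, ?_⟩
  have hcomp := congrArg (homogeneousComponent (d + 1)) hab
  rw [map_add, mul_comm g l, homogeneousComponent_mul_of_isHomogeneous hl, if_pos (by omega),
    Nat.add_sub_cancel, homogeneousComponent_eq_self hf] at hcomp
  rw [← hcomp, add_sub_cancel_right]
  exact hK a ha _

end MvPolynomial

theorem Monotone.finite_range_of_wellQuasiOrderedLE {α β : Type*} [Preorder α]
    [WellQuasiOrderedLE α] [PartialOrder β] [WellFoundedGT β] {f : α → β} (hf : Monotone f) :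
    (Set.range f).Finite := by
  by_contra hinf
  let u := Set.Infinite.natEmbedding _ hinf
  choose a ha using fun m ↦ (u m).2
  obtain ⟨g, hg⟩ := (wellQuasiOrdered_le (α := α)).exists_monotone_subseq a
  obtain ⟨m, hm⟩ := wellFoundedGT_iff_monotone_chain_condition.1 ‹WellFoundedGT β›
    ⟨fun j ↦ f (a (g j)), fun _ _ hij ↦ hf (hg _ _ hij)⟩
  have := hm (m + 1) m.le_succ
  simp only [OrderHom.coe_mk, ha] at this
  have := g.injective (u.injective (Subtype.ext this))
  omega

theorem exists_forall_ge_eq_of_succ_le {a : ℕ → ℕ} {d₀ : ℕ} (h : ∀ d ≥ d₀, a (d + 1) ≤ a d) :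
    ∃ d₁ D, ∀ d ≥ d₁, a d = D := by
  obtain ⟨m, hm⟩ := wellFoundedGT_iff_monotone_chain_condition.1 (inferInstance : WellFoundedGT ℕᵒᵈ)
    ⟨fun d ↦ OrderDual.toDual (a (d₀ + d)),
      monotone_nat_of_le_succ fun d ↦ h (d₀ + d) (Nat.le_add_right d₀ d)⟩
  refine ⟨d₀ + m, a (d₀ + m), fun d hd ↦ ?_⟩
  have : a (d₀ + m) = a (d₀ + (d - d₀)) := OrderDual.toDual.injective (hm (d - d₀) (by omega))
  rw [this, Nat.add_sub_cancel' (by omega)]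

instance homogPart_finite (M d : ℕ) : Module.Finite ℂ (homogPart M d) :=
  Module.Finite.iff_fg.2 (homogeneousSubmodule_fg (Fin (M + 1)) ℂ d)

theorem DeltaV_succ_le {M : ℕ} {J : Ideal (MvPolynomial (Fin (M + 1)) ℂ)}
    {l : MvPolynomial (Fin (M + 1)) ℂ} (hl : l.IsHomogeneous 1) {d : ℕ}
    (h : ∀ f : MvPolynomial (Fin (M + 1)) ℂ, f.IsHomogeneous (d + 1) →
      ∃ g : MvPolynomial (Fin (M + 1)) ℂ, g.IsHomogeneous d ∧ f - l * g ∈ J) :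
    DeltaV M J (d + 1) ≤ DeltaV M J d := by
  let φ : homogPart M d →ₗ[ℂ] homogPart M (d + 1) :=
    (LinearMap.mulLeft ℂ l).restrict fun g hg ↦ add_comm 1 d ▸ hl.mul hg
  let ψ := Submodule.mapQ ((J.restrictScalars ℂ).comap (homogPart M d).subtype)
    ((J.restrictScalars ℂ).comap (homogPart M (d + 1)).subtype) φ
    fun g hg ↦ J.mul_mem_left l hg
  refine LinearMap.finrank_le_finrank_of_surjective (f := ψ) fun y ↦ ?_
  obtain ⟨f, rfl⟩ := Submodule.mkQ_surjective _ y
  obtain ⟨g, hg, hfg⟩ := h f f.2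
  refine ⟨Submodule.mkQ _ ⟨g, hg⟩, ((Submodule.Quotient.eq _).2 ?_).symm⟩
  exact hfg

/-- The ideal generated by `I` and the monomials `r^𝐞` with `𝐞 >_lex 𝐢`. -/
noncomputable def lexTail {M n : ℕ} (I : Ideal (MvPolynomial (Fin (M + 1)) ℂ))
    (r : Fin n → MvPolynomial (Fin (M + 1)) ℂ) (i : Fin n → ℕ) :
    Ideal (MvPolynomial (Fin (M + 1)) ℂ) :=
  I ⊔ Ideal.span (rPow r '' {e | toLex i < toLex e})

/-- The colon ideal `(I + (r^𝐞 : 𝐞 >_lex 𝐢)) : r^𝐢`. -/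
noncomputable def lexColon {M n : ℕ} (I : Ideal (MvPolynomial (Fin (M + 1)) ℂ))
    (r : Fin n → MvPolynomial (Fin (M + 1)) ℂ) (i : Fin n → ℕ) :
    Ideal (MvPolynomial (Fin (M + 1)) ℂ) :=
  Submodule.comap (LinearMap.mulLeft (MvPolynomial (Fin (M + 1)) ℂ) (rPow r i)) (lexTail I r i)

section

variable {M n : ℕ} {I : Ideal (MvPolynomial (Fin (M + 1)) ℂ)}
  {r : Fin n → MvPolynomial (Fin (M + 1)) ℂ}

theorem mem_lexColon {i : Fin n → ℕ} {p : MvPolynomial (Fin (M + 1)) ℂ} :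
    p ∈ lexColon I r i ↔ rPow r i * p ∈ lexTail I r i := Iff.rfl

theorem rPow_add (i j : Fin n → ℕ) : rPow r (i + j) = rPow r i * rPow r j := by
  simp [rPow, pow_add, Finset.prod_mul_distrib]

theorem rPow_single (j : Fin n) : rPow r (Pi.single j 1) = r j := by
  classical
  rw [rPow, Finset.prod_eq_single j] <;> simp +contextual

theorem isHomogeneous_rPow (hr : ∀ j, (r j).IsHomogeneous 1) (i : Fin n → ℕ) :
    (rPow r i).IsHomogeneous (normI i) := by
  refine IsHomogeneous.prod _ _ _ fun j _ ↦ ?_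
  simpa using (hr j).pow (i j)

theorem lexColon_mono : Monotone (lexColon I r) := by
  intro i i' hii' p hp
  obtain ⟨c, rfl⟩ := exists_add_of_le hii'
  have hle : lexTail I r i ≤
      Submodule.comap (LinearMap.mulLeft _ (rPow r c)) (lexTail I r (i + c)) := by
    refine sup_le (fun q hq ↦ Ideal.mem_sup_left (I.mul_mem_left _ hq)) (Ideal.span_le.2 ?_)
    rintro _ ⟨e, he, rfl⟩
    refine Ideal.mem_sup_right (Ideal.subset_span ⟨e + c, ?_, ?_⟩)
    · exact add_lt_add_left (α := Lex (Fin n → ℕ)) he (toLex c)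
    · rw [rPow_add, mul_comm]; rfl
  rw [mem_lexColon, rPow_add, mul_comm (rPow r i), mul_assoc]
  exact hle hp

theorem sup_span_range_le_lexColon (i : Fin n → ℕ) :
    I ⊔ Ideal.span (Set.range r) ≤ lexColon I r i := by
  refine sup_le (fun p hp ↦ Ideal.mem_sup_left (I.mul_mem_left _ hp)) (Ideal.span_le.2 ?_)
  rintro _ ⟨j, rfl⟩
  refine Ideal.mem_sup_right (Ideal.subset_span ⟨i + Pi.single j 1, ?_, ?_⟩)
  · exact Pi.toLex_strictMono (lt_add_of_pos_right i (Pi.single_pos.2 one_pos))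
  · rw [rPow_add, rPow_single]; rfl

theorem mem_IfilSet_iff_s8 (hI : IsHomogeneousIdeal I) (hr : ∀ j, (r j).IsHomogeneous 1)
    {i : Fin n → ℕ} {N : ℕ} (hN : normI i ≤ N) {p : MvPolynomial (Fin (M + 1)) ℂ} :
    p ∈ IfilSet M n I r i N ↔ p ∈ homogPart M (N - normI i) ∧ p ∈ lexColon I r i := by
  constructor
  · rintro ⟨hp, s, c, hs, hmem, -⟩
    refine ⟨hp, ?_⟩
    rw [mem_lexColon, ← sub_add_cancel (rPow r i * p) (∑ e ∈ s, rPow r e * c e)]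
    refine add_mem (Ideal.mem_sup_left hmem) (Ideal.mem_sup_right (sum_mem fun e he ↦ ?_))
    exact Ideal.mul_mem_right _ _ (Ideal.subset_span ⟨e, (hs e he).1, rfl⟩)
  · rintro ⟨hp, hcolon⟩
    obtain ⟨a, ha, b, hb, hab⟩ := Submodule.mem_sup.1 (mem_lexColon.1 hcolon)
    obtain ⟨c, hc, rfl⟩ := (Finsupp.mem_span_image_iff_linearCombination _).1 hb
    have hp' : (rPow r i * p).IsHomogeneous N := by
      simpa [Nat.add_sub_cancel' hN] using (isHomogeneous_rPow hr i).mul hp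
    have hcomp := congrArg (homogeneousComponent N) hab
    rw [map_add, homogeneousComponent_eq_self hp', Finsupp.linearCombination_apply, Finsupp.sum,
      map_sum] at hcomp
    simp_rw [smul_eq_mul, mul_comm (c _),
      homogeneousComponent_mul_of_isHomogeneous (isHomogeneous_rPow hr _)] at hcomp
    rw [← Finset.sum_filter] at hcomp
    refine ⟨hp, c.support.filter fun e ↦ normI e ≤ N,
      fun e ↦ homogeneousComponent (N - normI e) (c e), fun e he ↦ ?_, ?_⟩
    · rw [Finset.mem_filter] at he
      exact ⟨hc he.1, he.2, homogeneousComponent_mem _ _⟩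
    · rw [← hcomp, add_sub_cancel_right]
      exact ⟨hI a ha N, homogeneousComponent_mem _ _⟩

theorem Delta_eq_DeltaV_lexColon (hI : IsHomogeneousIdeal I) (hr : ∀ j, (r j).IsHomogeneous 1)
    {i : Fin n → ℕ} {N : ℕ} (hN : normI i ≤ N) :
    Delta M n I r i N = DeltaV M (lexColon I r i) (N - normI i) := by
  have hset : IfilSet M n I r i N =
      (homogPart M (N - normI i) ⊓ (lexColon I r i).restrictScalars ℂ :
        Submodule ℂ (MvPolynomial (Fin (M + 1)) ℂ)) :=
    Set.ext fun p ↦ mem_IfilSet_iff_s8 hI hr hN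
  rw [Delta, DeltaV, hset, Submodule.span_eq, Submodule.comap_inf, Submodule.comap_subtype_self,
    top_inf_eq]

end

/-- If `ℂ[x]/(I + (r_1,…,r_n))` has Krull dimension at most `1`, then there is `N_0` such
that for each `𝐢` the quantity `Δ^𝐢_N` is independent of `N` as soon as `N - ‖𝐢‖ > N_0`. -/
theorem Delta_eventually_constant (M n : ℕ) (hM : 1 ≤ M) (hn : 1 ≤ n)
    (I : Ideal (MvPolynomial (Fin (M + 1)) ℂ)) (hI : IsHomogeneousIdeal I)
    (r : Fin n → MvPolynomial (Fin (M + 1)) ℂ)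
    (hr : ∀ j, r j ≠ 0 ∧ r j ∈ homogPart M 1)
    (hdim : ringKrullDim
      (MvPolynomial (Fin (M + 1)) ℂ ⧸ (I ⊔ Ideal.span (Set.range r))) ≤ 1) :
    ∃ N₀ : ℕ, ∀ i : Fin n → ℕ, ∃ D : ℕ,
      ∀ N : ℕ, N₀ + normI i < N → Delta M n I r i N = D := by
  have hr' (j : Fin n) : (r j).IsHomogeneous 1 := (hr j).2
  have hK := homogeneousComponent_mem_sup_span hI (S := Set.range r)
    (by rintro _ ⟨j, rfl⟩; exact ⟨1, hr' j⟩)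
  obtain ⟨l, hl, d₀, hd₀⟩ := exists_linear_form_of_krullDimLE_one hK
    (Ring.krullDimLE_iff.2 hdim)
  have hconst (i : Fin n → ℕ) : ∃ d₁ D, ∀ d ≥ d₁, DeltaV M (lexColon I r i) d = D :=
    exists_forall_ge_eq_of_succ_le fun d hd ↦ DeltaV_succ_le hl fun f hf ↦
      (hd₀ d hd f hf).imp fun g hg ↦ ⟨hg.1, sup_span_range_le_lexColon i hg.2⟩
  have hconst' : ∀ J ∈ Set.range (lexColon I r), ∃ d₁ D, ∀ d ≥ d₁, DeltaV M J d = D := by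
    rintro _ ⟨i, rfl⟩
    exact hconst i
  choose! d₁ D hD using hconst'
  have hfin := (lexColon_mono (I := I) (r := r)).finite_range_of_wellQuasiOrderedLE
  obtain ⟨N₀, hN₀⟩ := (hfin.image d₁).bddAbove
  refine ⟨N₀, fun i ↦ ⟨D (lexColon I r i), fun N hN ↦ ?_⟩⟩
  have hd₁ : d₁ (lexColon I r i) ≤ N₀ :=
    hN₀ (Set.mem_image_of_mem _ (Set.mem_range_self i))
  rw [Delta_eq_DeltaV_lexColon hI hr' (by omega)]
  exact hD _ (Set.mem_range_self i) _ (by omega)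
end
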